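/- In the first-price auction, fix an equilibrium strategy profile, a utility maximizer i ∈ B_u and an auction j; let v = v i j, let F(s) = P(max_{i' ≠ i} b i' j ≤ s) be the CDF of the highest competing bid in auction j, let G(x) = sup{ v·F(s) : s ≥ 0, s·F(s) ≤ x } for x ≥ 0, and let H be the concave envelope of G on [0,∞), i.e., H(w) = sup{ a·G(x₁) + (1−a)·G(x₂) : a ∈ [0,1], x₁, x₂ ≥ 0, a·x₁ + (1−a)·x₂ = w }. Then for every b ≥ 0 in the support of the distribution of bidder i's bid b i j, and every w ≥ b·F(b): H(w) − H(b·F(b)) ≤ w − b·F(b). -/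

import Mathlib

open MeasureTheory Finset
open scoped Classical

namespace FPA

variable {n m : ℕ}

/-- Bidder `i` wins auction `j` under bid profile `b`: highest bid, ties broken
in favor of larger value, then smaller index. -/
def Wins (v b : Fin n → Fin m → ℝ) (j : Fin m) (i : Fin n) : Prop :=
  ∀ i', i' ≠ i →
    b i' j < b i j ∨ (b i' j = b i j ∧ (v i' j < v i j ∨ (v i' j = v i j ∧ i < i')))

/-- Indicator that bidder `i` wins auction `j`. -/
noncomputable def xind (v b : Fin n → Fin m → ℝ) (j : Fin m) (i : Fin n) : ℝ :=
  if Wins v b j i then 1 else 0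

noncomputable def valij (v b : Fin n → Fin m → ℝ) (i : Fin n) (j : Fin m) : ℝ :=
  xind v b j i * v i j

noncomputable def payij (v b : Fin n → Fin m → ℝ) (i : Fin n) (j : Fin m) : ℝ :=
  xind v b j i * b i j

/-- Admissible strategy: probability distribution over nonnegative bid vectors
with finite expectations. -/
def Admissible (σ : Measure (Fin m → ℝ)) : Prop :=
  IsProbabilityMeasure σ ∧ (∀ᵐ β ∂σ, ∀ j, 0 ≤ β j) ∧ ∀ j, Integrable (fun β => β j) σ

noncomputable def EValij (v : Fin n → Fin m → ℝ) (μ : Fin n → Measure (Fin m → ℝ))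
    (i : Fin n) (j : Fin m) : ℝ :=
  ∫ b, valij v b i j ∂(Measure.pi μ)

noncomputable def EPayij (v : Fin n → Fin m → ℝ) (μ : Fin n → Measure (Fin m → ℝ))
    (i : Fin n) (j : Fin m) : ℝ :=
  ∫ b, payij v b i j ∂(Measure.pi μ)

noncomputable def EVal (v : Fin n → Fin m → ℝ) (μ : Fin n → Measure (Fin m → ℝ))
    (i : Fin n) : ℝ :=
  ∑ j, EValij v μ i j

noncomputable def EPay (v : Fin n → Fin m → ℝ) (μ : Fin n → Measure (Fin m → ℝ))
    (i : Fin n) : ℝ :=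
  ∑ j, EPayij v μ i j

noncomputable def EUtil (v : Fin n → Fin m → ℝ) (μ : Fin n → Measure (Fin m → ℝ))
    (i : Fin n) : ℝ :=
  EVal v μ i - EPay v μ i

/-- A utility maximizer best responds: no admissible deviation improves expected utility. -/
def UtilBest (v : Fin n → Fin m → ℝ) (μ : Fin n → Measure (Fin m → ℝ)) (i : Fin n) : Prop :=
  ∀ σ, Admissible σ → EUtil v (Function.update μ i σ) i ≤ EUtil v μ i

/-- A value maximizer best responds: its ROI constraint holds and no admissible
deviation satisfying the ROI constraint yields more expected value. -/
def ValBest (v : Fin n → Fin m → ℝ) (μ : Fin n → Measure (Fin m → ℝ)) (i : Fin n) : Prop :=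
  EPay v μ i ≤ EVal v μ i ∧
    ∀ σ, Admissible σ →
      EPay v (Function.update μ i σ) i ≤ EVal v (Function.update μ i σ) i →
      EVal v (Function.update μ i σ) i ≤ EVal v μ i

/-- Equilibrium: all strategies admissible, every utility maximizer in `Bu` and
every value maximizer in `Bv` best responds. -/
def Equilibrium (v : Fin n → Fin m → ℝ) (Bu Bv : Finset (Fin n))
    (μ : Fin n → Measure (Fin m → ℝ)) : Prop :=
  (∀ i, Admissible (μ i)) ∧ (∀ i ∈ Bu, UtilBest v μ i) ∧ (∀ i ∈ Bv, ValBest v μ i)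

/-- The rightful winner of auction `j`: the bidder with the highest value,
ties broken toward the smaller index. -/
noncomputable def rwinner [NeZero n] (v : Fin n → Fin m → ℝ) (j : Fin m) : Fin n :=
  (Finset.univ.filter fun i => ∀ i', v i' j ≤ v i j).min' (by
    obtain ⟨i, -, hi⟩ := Finset.exists_max_image (Finset.univ : Finset (Fin n))
      (fun i => v i j) Finset.univ_nonempty
    exact ⟨i, Finset.mem_filter.mpr ⟨Finset.mem_univ _, fun i' => hi i' (Finset.mem_univ _)⟩⟩)

end FPA

open MeasureTheory Finset

/-- The topological support of a measure on `ℝ`: points all of whose open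
neighborhoods have positive measure. -/
def measSupport (ν : Measure ℝ) : Set ℝ :=
  {x | ∀ U : Set ℝ, IsOpen U → x ∈ U → 0 < ν U}

namespace FPA

variable {n m : ℕ}

lemma Wins.le {v b : Fin n → Fin m → ℝ} {j : Fin m} {i : Fin n} (h : Wins v b j i)
    {i' : Fin n} (hi' : i' ≠ i) : b i' j ≤ b i j := by
  rcases h i' hi' with h | h
  · exact h.le
  · exact h.1.le

lemma measurableSet_wins (v : Fin n → Fin m → ℝ) (j : Fin m) (i : Fin n) :
    MeasurableSet {b : Fin n → Fin m → ℝ | Wins v b j i} := by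
  have h (k : Fin n) : Measurable fun b : Fin n → Fin m → ℝ => b k j := by fun_prop
  simp only [Wins, Set.ofPred_forall]
  refine MeasurableSet.iInter fun i' => MeasurableSet.iInter fun _ => ?_
  exact (measurableSet_lt (h i') (h i)).union
    ((measurableSet_eq_fun (h i') (h i)).inter (MeasurableSet.const _))

lemma xind_nonneg (v b : Fin n → Fin m → ℝ) (j : Fin m) (i : Fin n) : 0 ≤ xind v b j i := by
  unfold xind
  split_ifs <;> norm_num

lemma xind_le_one (v b : Fin n → Fin m → ℝ) (j : Fin m) (i : Fin n) : xind v b j i ≤ 1 := by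
  unfold xind
  split_ifs <;> norm_num

lemma measurable_xind (v : Fin n → Fin m → ℝ) (j : Fin m) (i : Fin n) :
    Measurable fun b => xind v b j i :=
  Measurable.ite (measurableSet_wins v j i) measurable_const measurable_const

lemma measurable_valij (v : Fin n → Fin m → ℝ) (i : Fin n) (j : Fin m) :
    Measurable fun b => valij v b i j :=
  (measurable_xind v j i).mul_const _

lemma measurable_payij (v : Fin n → Fin m → ℝ) (i : Fin n) (j : Fin m) :
    Measurable fun b => payij v b i j :=
  (measurable_xind v j i).mul (by fun_prop)

lemma integrable_valij (v : Fin n → Fin m → ℝ) {μ : Fin n → Measure (Fin m → ℝ)}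
    (hμ : ∀ i, Admissible (μ i)) (i : Fin n) (j : Fin m) :
    Integrable (fun b => valij v b i j) (Measure.pi μ) := by
  have := fun i => (hμ i).1
  refine Integrable.mono' (integrable_const |v i j|)
    (measurable_valij v i j).aestronglyMeasurable (.of_forall fun b => ?_)
  rw [valij, Real.norm_eq_abs, abs_mul, abs_of_nonneg (xind_nonneg v b j i)]
  exact mul_le_of_le_one_left (abs_nonneg _) (xind_le_one v b j i)

lemma integrable_payij (v : Fin n → Fin m → ℝ) {μ : Fin n → Measure (Fin m → ℝ)}
    (hμ : ∀ i, Admissible (μ i)) (i : Fin n) (j : Fin m) :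
    Integrable (fun b => payij v b i j) (Measure.pi μ) := by
  have := fun i => (hμ i).1
  have hb : Integrable (fun b : Fin n → Fin m → ℝ => b i j) (Measure.pi μ) :=
    (measurePreserving_eval μ i).integrable_comp_of_integrable ((hμ i).2.2 j)
  refine Integrable.mono' hb.abs
    (measurable_payij v i j).aestronglyMeasurable (.of_forall fun b => ?_)
  rw [payij, Real.norm_eq_abs, abs_mul, abs_of_nonneg (xind_nonneg v b j i)]
  exact mul_le_of_le_one_left (abs_nonneg _) (xind_le_one v b j i)

/-- Change the bid in auction `j` to `s` whenever it lies in `A`. -/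
noncomputable def deviate (A : Set ℝ) (s : ℝ) (j : Fin m) (β : Fin m → ℝ) : Fin m → ℝ :=
  if β j ∈ A then Function.update β j s else β

lemma deviate_of_mem {A : Set ℝ} {s : ℝ} {j : Fin m} {β : Fin m → ℝ} (h : β j ∈ A) :
    deviate A s j β = Function.update β j s := if_pos h

lemma deviate_of_notMem {A : Set ℝ} {s : ℝ} {j : Fin m} {β : Fin m → ℝ} (h : β j ∉ A) :
    deviate A s j β = β := if_neg h

lemma deviate_apply_of_ne (A : Set ℝ) (s : ℝ) {j j' : Fin m} (h : j' ≠ j) (β : Fin m → ℝ) :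
    deviate A s j β j' = β j' := by
  by_cases hA : β j ∈ A
  · simp [deviate_of_mem hA, h]
  · rw [deviate_of_notMem hA]

lemma deviate_apply_eq_or (A : Set ℝ) (s : ℝ) (j j' : Fin m) (β : Fin m → ℝ) :
    deviate A s j β j' = s ∨ deviate A s j β j' = β j' := by
  rcases eq_or_ne j' j with rfl | h
  · by_cases hA : β j' ∈ A
    · simp [deviate_of_mem hA]
    · simp [deviate_of_notMem hA]
  · exact .inr (deviate_apply_of_ne A s h β)

lemma measurable_deviate {A : Set ℝ} (hA : MeasurableSet A) (s : ℝ) (j : Fin m) :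
    Measurable (deviate A s j) := by
  refine Measurable.ite ((measurable_pi_apply j) hA) ?_ measurable_id
  exact measurable_update_left

lemma Admissible.map_deviate {σ : Measure (Fin m → ℝ)} (hσ : Admissible σ) {A : Set ℝ}
    (hA : MeasurableSet A) {s : ℝ} (hs : 0 ≤ s) (j : Fin m) :
    Admissible (σ.map (deviate A s j)) := by
  obtain ⟨hp, h0, hI⟩ := hσ
  have hd := measurable_deviate hA s j
  refine ⟨Measure.isProbabilityMeasure_map hd.aemeasurable, ?_, fun j' => ?_⟩
  · rw [ae_map_iff hd.aemeasurable (by measurability)]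
    filter_upwards [h0] with β hβ j'
    rcases deviate_apply_eq_or A s j j' β with h | h <;> rw [h]
    exacts [hs, hβ j']
  · have hj : Measurable fun β : Fin m → ℝ => β j' := by fun_prop
    rw [integrable_map_measure hj.aestronglyMeasurable hd.aemeasurable]
    refine Integrable.mono' ((hI j').abs.add (integrable_const |s|))
      (hj.comp hd).aestronglyMeasurable (.of_forall fun β => ?_)
    simp only [Function.comp_apply, Real.norm_eq_abs, Pi.add_apply]
    rcases deviate_apply_eq_or A s j j' β with h | h <;> rw [h] <;>
      linarith [abs_nonneg s, abs_nonneg (β j')]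

/-- The bid profile after bidder `i` applies `deviate`. -/
noncomputable def deviateProfile (i : Fin n) (A : Set ℝ) (s : ℝ) (j : Fin m)
    (b : Fin n → Fin m → ℝ) : Fin n → Fin m → ℝ :=
  Function.update b i (deviate A s j (b i))

lemma measurable_deviateProfile (i : Fin n) {A : Set ℝ} (hA : MeasurableSet A) (s : ℝ)
    (j : Fin m) : Measurable (deviateProfile i A s j) := by
  refine measurable_pi_lambda _ fun k => ?_
  rcases eq_or_ne k i with rfl | hk
  · simp only [deviateProfile, Function.update_self]
    exact (measurable_deviate hA s j).comp (measurable_pi_apply k)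
  · simpa [deviateProfile, hk] using measurable_pi_apply k

lemma pi_map_deviateProfile {μ : Fin n → Measure (Fin m → ℝ)}
    (hμ : ∀ i, Admissible (μ i)) (i : Fin n) {A : Set ℝ} (hA : MeasurableSet A) (s : ℝ)
    (j : Fin m) :
    Measure.pi (Function.update μ i ((μ i).map (deviate A s j))) =
      (Measure.pi μ).map (deviateProfile i A s j) := by
  have := fun i => (hμ i).1
  let f : Fin n → (Fin m → ℝ) → Fin m → ℝ := Function.update (fun _ => id) i (deviate A s j)
  have hf (k : Fin n) : Measurable (f k) := by
    rcases eq_or_ne k i with rfl | hk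
    · simpa [f] using measurable_deviate hA s j
    · simpa [f, hk] using measurable_id
  have (k : Fin n) : IsProbabilityMeasure ((μ k).map (f k)) :=
    Measure.isProbabilityMeasure_map (hf k).aemeasurable
  have h1 : Function.update μ i ((μ i).map (deviate A s j)) = fun k => (μ k).map (f k) := by
    ext1 k
    rcases eq_or_ne k i with rfl | hk
    · simp [f]
    · simp [f, hk]
  have h2 : deviateProfile i A s j = fun b k => f k (b k) := by
    ext1 b
    ext1 k
    rcases eq_or_ne k i with rfl | hk
    · simp [f, deviateProfile]
    · simp [f, hk, deviateProfile]
  rw [h1, h2, Measure.pi_map_pi fun k => (hf k).aemeasurable]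

lemma xind_congr {v b b' : Fin n → Fin m → ℝ} {j : Fin m} (h : ∀ k, b k j = b' k j)
    (i : Fin n) : xind v b j i = xind v b' j i := by
  have hiff : Wins v b j i ↔ Wins v b' j i := by simp only [Wins, h]
  simp only [xind, hiff]

lemma deviateProfile_apply_of_ne (i : Fin n) (A : Set ℝ) (s : ℝ) {j j' : Fin m} (h : j' ≠ j)
    (b : Fin n → Fin m → ℝ) (k : Fin n) : deviateProfile i A s j b k j' = b k j' := by
  rcases eq_or_ne k i with rfl | hk
  · simp [deviateProfile, deviate_apply_of_ne A s h]
  · simp [deviateProfile, hk]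

lemma deviateProfile_of_notMem {i : Fin n} {A : Set ℝ} {s : ℝ} {j : Fin m}
    {b : Fin n → Fin m → ℝ} (h : b i j ∉ A) : deviateProfile i A s j b = b := by
  rw [deviateProfile, deviate_of_notMem h, Function.update_eq_self]

/-- The ex-post utility of bidder `i` in auction `j`. -/
noncomputable def utilij (v b : Fin n → Fin m → ℝ) (i : Fin n) (j : Fin m) : ℝ :=
  xind v b j i * (v i j - b i j)

lemma utilij_eq (v b : Fin n → Fin m → ℝ) (i : Fin n) (j : Fin m) :
    utilij v b i j = valij v b i j - payij v b i j := mul_sub _ _ _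

lemma integrable_utilij (v : Fin n → Fin m → ℝ) {μ : Fin n → Measure (Fin m → ℝ)}
    (hμ : ∀ i, Admissible (μ i)) (i : Fin n) (j : Fin m) :
    Integrable (fun b => utilij v b i j) (Measure.pi μ) := by
  simp only [utilij_eq]
  exact (integrable_valij v hμ i j).sub (integrable_payij v hμ i j)

lemma eUtil_eq_sum_integral (v : Fin n → Fin m → ℝ) {μ : Fin n → Measure (Fin m → ℝ)}
    (hμ : ∀ i, Admissible (μ i)) (i : Fin n) :
    EUtil v μ i = ∑ j, ∫ b, utilij v b i j ∂(Measure.pi μ) := by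
  rw [EUtil, EVal, EPay, ← Finset.sum_sub_distrib]
  refine Finset.sum_congr rfl fun j _ => ?_
  simp only [utilij_eq]
  exact (integral_sub (integrable_valij v hμ i j) (integrable_payij v hμ i j)).symm

lemma integrable_and_integral_utilij_deviateProfile_le {v : Fin n → Fin m → ℝ}
    {μ : Fin n → Measure (Fin m → ℝ)} (hμ : ∀ i, Admissible (μ i)) {i : Fin n}
    (hbest : UtilBest v μ i) (j : Fin m) {A : Set ℝ} (hA : MeasurableSet A) {s : ℝ}
    (hs : 0 ≤ s) :
    Integrable (fun b => utilij v (deviateProfile i A s j b) i j) (Measure.pi μ) ∧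
      ∫ b, utilij v (deviateProfile i A s j b) i j ∂(Measure.pi μ) ≤
        ∫ b, utilij v b i j ∂(Measure.pi μ) := by
  have hσ := (hμ i).map_deviate hA hs j
  have hμ' : ∀ k, Admissible (Function.update μ i ((μ i).map (deviate A s j)) k) := by
    intro k
    rcases eq_or_ne k i with rfl | hk
    · simpa using hσ
    · simpa [hk] using hμ k
  have hT := measurable_deviateProfile i hA s j
  have hmeas (j' : Fin m) : Measurable fun b => utilij v b i j' := by
    simp only [utilij_eq]
    exact (measurable_valij v i j').sub (measurable_payij v i j')
  have hle := hbest _ hσ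
  have hint := integrable_utilij v hμ' i j
  rw [pi_map_deviateProfile hμ i hA s j,
    integrable_map_measure (hmeas j).aestronglyMeasurable hT.aemeasurable] at hint
  refine ⟨hint, ?_⟩
  rw [eUtil_eq_sum_integral v hμ', eUtil_eq_sum_integral v hμ, pi_map_deviateProfile hμ i hA s j,
    ← Finset.add_sum_erase _ _ (Finset.mem_univ j),
    ← Finset.add_sum_erase univ (fun j' => ∫ b, utilij v b i j' ∂(Measure.pi μ))
      (Finset.mem_univ j)] at hle
  simp only [integral_map hT.aemeasurable (hmeas _).aestronglyMeasurable] at hle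
  have hother : ∑ j' ∈ univ.erase j,
      ∫ b, utilij v (deviateProfile i A s j b) i j' ∂(Measure.pi μ) =
      ∑ j' ∈ univ.erase j, ∫ b, utilij v b i j' ∂(Measure.pi μ) := by
    refine Finset.sum_congr rfl fun j' hj' => integral_congr_ae (.of_forall fun b => ?_)
    have h := deviateProfile_apply_of_ne i A s (Finset.ne_of_mem_erase hj') b
    simp only [utilij, xind_congr h i, h i]
  linarith

/-- The event that every competitor of bidder `i` bids at most `t` in auction `j`. -/
def rivalsLE (i : Fin n) (j : Fin m) (t : ℝ) : Set (Fin n → Fin m → ℝ) :=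
  {b | ∀ k, k ≠ i → b k j ≤ t}

lemma measurableSet_rivalsLE (i : Fin n) (j : Fin m) (t : ℝ) :
    MeasurableSet (rivalsLE i j t) := by
  simp only [rivalsLE, Set.ofPred_forall]
  refine MeasurableSet.iInter fun k => MeasurableSet.iInter fun _ => ?_
  exact measurableSet_le (by fun_prop) measurable_const

/-- Bidder `i`'s own bid is independent of the competing bids. -/
lemma pi_bid_inter_rivalsLE (μ : Fin n → Measure (Fin m → ℝ))
    [∀ i, IsProbabilityMeasure (μ i)] (i : Fin n) (j : Fin m) (A : Set ℝ) (t : ℝ) :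
    Measure.pi μ ({b | b i j ∈ A} ∩ rivalsLE i j t) =
      μ i {β | β j ∈ A} * Measure.pi μ (rivalsLE i j t) := by
  have key (B : Set ℝ) : Measure.pi μ ({b | b i j ∈ B} ∩ rivalsLE i j t) =
      μ i {β | β j ∈ B} * ∏ k ∈ univ.erase i, μ k {β | β j ≤ t} := by
    have : {b | b i j ∈ B} ∩ rivalsLE i j t = Set.univ.pi
        (Function.update (fun _ : Fin n => {β : Fin m → ℝ | β j ≤ t}) i {β | β j ∈ B}) := by
      ext b
      simp only [rivalsLE, Set.mem_inter_iff, Set.mem_ofPred_eq, Set.mem_pi, Set.mem_univ,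
        true_imp_iff]
      constructor
      · rintro ⟨h1, h2⟩ k
        rcases eq_or_ne k i with rfl | hk
        · simpa using h1
        · simpa [hk] using h2 k hk
      · intro h
        exact ⟨by simpa using h i, fun k hk => by simpa [hk] using h k⟩
    rw [this, Measure.pi_pi, ← Finset.mul_prod_erase _ _ (Finset.mem_univ i)]
    congr 1
    · simp
    · refine Finset.prod_congr rfl fun k hk => ?_
      simp [Finset.ne_of_mem_erase hk]
  have huniv := key Set.univ
  simp only [Set.mem_univ, Set.ofPred_true, Set.univ_inter, measure_univ, one_mul] at huniv
  rw [key A, huniv]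

/-- A comparison of ex-post utilities on an event of positive probability for the own bid
passes, in a best response, to the distribution of the competing bids. -/
lemma UtilBest.expected_gap_nonneg {v : Fin n → Fin m → ℝ}
    {μ : Fin n → Measure (Fin m → ℝ)} (hμ : ∀ i, Admissible (μ i)) {i : Fin n}
    (hbest : UtilBest v μ i) (j : Fin m) {A : Set ℝ} (hA : MeasurableSet A)
    (hpos : 0 < μ i {β | β j ∈ A}) {s : ℝ} (hs : 0 ≤ s) {c₁ t₁ c₂ t₂ : ℝ}
    (hgap : ∀ b : Fin n → Fin m → ℝ, b i j ∈ A →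
      utilij v b i j - utilij v (Function.update b i (Function.update (b i) j s)) i j ≤
        (rivalsLE i j t₁).indicator (fun _ => c₁) b -
          (rivalsLE i j t₂).indicator (fun _ => c₂) b) :
    (Measure.pi μ).real (rivalsLE i j t₂) * c₂ ≤
      (Measure.pi μ).real (rivalsLE i j t₁) * c₁ := by
  have := fun i => (hμ i).1
  obtain ⟨hint, hle⟩ := integrable_and_integral_utilij_deviateProfile_le hμ hbest j hA hs
  set E : Set (Fin n → Fin m → ℝ) := {b | b i j ∈ A} with hE
  have hEm : MeasurableSet E :=
    (show Measurable fun b : Fin n → Fin m → ℝ => b i j by fun_prop) hA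
  have hind (c t : ℝ) :
      Integrable ((E ∩ rivalsLE i j t).indicator fun _ => c) (Measure.pi μ) :=
    (integrable_const c).indicator (hEm.inter (measurableSet_rivalsLE i j t))
  have hval (c t : ℝ) : ∫ b, (E ∩ rivalsLE i j t).indicator (fun _ => c) b ∂(Measure.pi μ) =
      (μ i).real {β | β j ∈ A} * ((Measure.pi μ).real (rivalsLE i j t) * c) := by
    rw [integral_indicator_const _ (hEm.inter (measurableSet_rivalsLE i j t)), measureReal_def,
      pi_bid_inter_rivalsLE, ENNReal.toReal_mul, smul_eq_mul, mul_assoc]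
    rfl
  have hmono : ∫ b, (utilij v b i j - utilij v (deviateProfile i A s j b) i j) ∂(Measure.pi μ) ≤
      ∫ b, ((E ∩ rivalsLE i j t₁).indicator (fun _ => c₁) b -
        (E ∩ rivalsLE i j t₂).indicator (fun _ => c₂) b) ∂(Measure.pi μ) := by
    refine integral_mono ((integrable_utilij v hμ i j).sub hint)
      ((hind c₁ t₁).sub (hind c₂ t₂)) fun b => ?_
    by_cases hb : b i j ∈ A
    · have hbE : b ∈ E := hb
      have h := hgap b hb
      simp only [deviateProfile, deviate_of_mem hb]
      simpa [Set.indicator, hbE] using h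
    · have hbE : b ∉ E := hb
      simp [deviateProfile_of_notMem hb, Set.indicator, hbE]
  rw [integral_sub (integrable_utilij v hμ i j) hint, integral_sub (hind _ _) (hind _ _),
    hval, hval, ← mul_sub] at hmono
  have hpos' : 0 < (μ i).real {β | β j ∈ A} := ENNReal.toReal_pos hpos.ne' (measure_ne_top _ _)
  have := nonneg_of_mul_nonneg_right ((sub_nonneg.2 hle).trans hmono) hpos'
  linarith

lemma utilij_update_of_rivalsLE {v b : Fin n → Fin m → ℝ} {i : Fin n} {j : Fin m} {s t : ℝ}
    (hb : b ∈ rivalsLE i j t) (hts : t < s) :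
    utilij v (Function.update b i (Function.update (b i) j s)) i j = v i j - s := by
  have hw : Wins v (Function.update b i (Function.update (b i) j s)) j i := fun k hk => by
    left
    simpa [hk] using (hb k hk).trans_lt hts
  simp [utilij, xind, hw]

lemma utilij_update_nonneg {v : Fin n → Fin m → ℝ} {i : Fin n} {j : Fin m} {s : ℝ}
    (hs : s ≤ v i j) (b : Fin n → Fin m → ℝ) :
    0 ≤ utilij v (Function.update b i (Function.update (b i) j s)) i j :=
  mul_nonneg (xind_nonneg _ _ _ _) (by simpa using hs)

/-- A bid `b` in the support that is at most the value earns the best possible utility. -/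
lemma UtilBest.gap_of_le {v : Fin n → Fin m → ℝ}
    {μ : Fin n → Measure (Fin m → ℝ)} (hμ : ∀ i, Admissible (μ i)) {i : Fin n}
    (hbest : UtilBest v μ i) (j : Fin m) {b δ s t : ℝ} (hbv : b ≤ v i j) (hδ : 0 ≤ δ)
    (hpos : 0 < μ i {β | β j ∈ Set.Ioo (b - δ) (b + δ)}) (hs : 0 ≤ s) (hts : t < s)
    (hsv : s ≤ v i j) :
    (Measure.pi μ).real (rivalsLE i j t) * (v i j - s) ≤
      (Measure.pi μ).real (rivalsLE i j (b + δ)) * (v i j - b + δ) := by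
  refine hbest.expected_gap_nonneg hμ j measurableSet_Ioo hpos hs fun x hx => sub_le_sub ?_ ?_
  · by_cases hw : Wins v x j i
    · have hmem : x ∈ rivalsLE i j (b + δ) := fun k hk => (hw.le hk).trans hx.2.le
      rw [Set.indicator_of_mem hmem]
      simp only [utilij, xind, hw, if_true]
      linarith [hx.1]
    · simp only [utilij, xind, hw, if_false, zero_mul]
      exact Set.indicator_nonneg (fun _ _ => by linarith) _
  · by_cases hx : x ∈ rivalsLE i j t
    · rw [Set.indicator_of_mem hx, utilij_update_of_rivalsLE hx hts]
    · rw [Set.indicator_of_notMem hx]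
      exact utilij_update_nonneg hsv x

/-- A bid in the support that exceeds the value almost surely does not win strictly. -/
lemma UtilBest.rivalsLE_eq_zero {v : Fin n → Fin m → ℝ} (hv : ∀ i j, 0 ≤ v i j)
    {μ : Fin n → Measure (Fin m → ℝ)} (hμ : ∀ i, Admissible (μ i)) {i : Fin n}
    (hbest : UtilBest v μ i) (j : Fin m) {b δ : ℝ} (hbv : v i j < b - δ)
    (hpos : 0 < μ i {β | β j ∈ Set.Ioo (b - δ) (b + δ)}) :
    (Measure.pi μ).real (rivalsLE i j (b - δ)) = 0 := by
  have h := hbest.expected_gap_nonneg hμ j measurableSet_Ioo hpos (hv i j)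
    (c₁ := v i j - (b - δ)) (t₁ := b - δ) (c₂ := 0) (t₂ := 0) fun x hx => by
      have h0 := utilij_update_nonneg (le_refl (v i j)) x
      have h1 : utilij v x i j ≤ (rivalsLE i j (b - δ)).indicator
          (fun _ => v i j - (b - δ)) x := by
        by_cases hm : x ∈ rivalsLE i j (b - δ)
        · have hw : Wins v x j i := fun k hk => .inl ((hm k hk).trans_lt hx.1)
          rw [Set.indicator_of_mem hm]
          simp only [utilij, xind, hw, if_true]
          linarith [hx.1]
        · rw [Set.indicator_of_notMem hm]
          exact mul_nonpos_of_nonneg_of_nonpos (xind_nonneg _ _ _ _) (by linarith [hx.1])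
      simp only [Set.indicator_zero, sub_zero]
      linarith
  have hn : 0 ≤ (Measure.pi μ).real (rivalsLE i j (b - δ)) := measureReal_nonneg
  nlinarith

end FPA

/-- An affine majorant of the frontier `G` that is attained at `x₀` bounds the increments
of its concave envelope. -/
lemma concaveEnvelope_sub_le {G H : ℝ → ℝ} {A C x₀ w : ℝ} (hA : A ≤ 1)
    (hle : ∀ x, 0 ≤ x → G x ≤ A * x + C) (hx₀ : 0 ≤ x₀) (hge : A * x₀ + C ≤ G x₀)
    (hH : ∀ w : ℝ, 0 ≤ w →
      H w = sSup {y : ℝ | ∃ a ∈ Set.Icc (0 : ℝ) 1, ∃ x₁ : ℝ, 0 ≤ x₁ ∧ ∃ x₂ : ℝ, 0 ≤ x₂ ∧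
        a * x₁ + (1 - a) * x₂ = w ∧ y = a * G x₁ + (1 - a) * G x₂})
    (hw : x₀ ≤ w) : H w - H x₀ ≤ w - x₀ := by
  have hub (w : ℝ) : A * w + C ∈ upperBounds {y : ℝ | ∃ a ∈ Set.Icc (0 : ℝ) 1, ∃ x₁ : ℝ,
      0 ≤ x₁ ∧ ∃ x₂ : ℝ, 0 ≤ x₂ ∧
        a * x₁ + (1 - a) * x₂ = w ∧ y = a * G x₁ + (1 - a) * G x₂} := by
    rintro y ⟨a, ha, x₁, hx₁, x₂, hx₂, rfl, rfl⟩
    have h1 := mul_le_mul_of_nonneg_left (hle x₁ hx₁) ha.1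
    have h2 := mul_le_mul_of_nonneg_left (hle x₂ hx₂) (sub_nonneg.2 ha.2)
    linarith
  have hmem {w : ℝ} (hw : 0 ≤ w) : G w ∈ {y : ℝ | ∃ a ∈ Set.Icc (0 : ℝ) 1, ∃ x₁ : ℝ,
      0 ≤ x₁ ∧ ∃ x₂ : ℝ, 0 ≤ x₂ ∧
        a * x₁ + (1 - a) * x₂ = w ∧ y = a * G x₁ + (1 - a) * G x₂} :=
    ⟨1, by simp, w, hw, w, hw, by ring, by ring⟩
  have h1 : H w ≤ A * w + C := by
    rw [hH w (hx₀.trans hw)]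
    exact csSup_le ⟨_, hmem (hx₀.trans hw)⟩ (hub w)
  have h2 : G x₀ ≤ H x₀ := by
    rw [hH x₀ hx₀]
    exact le_csSup ⟨_, hub x₀⟩ (hmem hx₀)
  nlinarith

/-- Lemma 1 of the paper. Fix an equilibrium, a utility maximizer
`i` and an auction `j`; let `F` be the CDF of the highest competing bid in auction
`j`, `G` the value-payment frontier for deterministic bids, and `H` its concave
envelope.  Then for every `b ≥ 0` in the support of the law of `i`'s bid in auction
`j` and every `w ≥ b·F(b)`, we have `H(w) - H(b·F(b)) ≤ w - b·F(b)`. -/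
theorem fpa_frontier_marginal {n m : ℕ} [NeZero n]
    (v : Fin n → Fin m → ℝ) (hv : ∀ i j, 0 ≤ v i j)
    (Bu Bv : Finset (Fin n)) (hdisj : Disjoint Bu Bv) (hcover : Bu ∪ Bv = Finset.univ)
    (μ : Fin n → Measure (Fin m → ℝ))
    (heq : FPA.Equilibrium v Bu Bv μ)
    (i : Fin n) (hi : i ∈ Bu) (j : Fin m)
    (hne : (Finset.univ.erase i).Nonempty)
    (F G H : ℝ → ℝ)
    (hF : ∀ s : ℝ, F s =
      ((Measure.pi μ)
        {b : Fin n → Fin m → ℝ |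
          (Finset.univ.erase i).sup' hne (fun i' => b i' j) ≤ s}).toReal)
    (hG : ∀ x : ℝ, 0 ≤ x →
      G x = sSup {y : ℝ | ∃ s : ℝ, 0 ≤ s ∧ s * F s ≤ x ∧ y = v i j * F s})
    (hH : ∀ w : ℝ, 0 ≤ w →
      H w = sSup {y : ℝ | ∃ a ∈ Set.Icc (0 : ℝ) 1, ∃ x₁ : ℝ, 0 ≤ x₁ ∧ ∃ x₂ : ℝ, 0 ≤ x₂ ∧
        a * x₁ + (1 - a) * x₂ = w ∧ y = a * G x₁ + (1 - a) * G x₂})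
    (b : ℝ) (hb : 0 ≤ b)
    (hsupp : b ∈ measSupport ((μ i).map fun β => β j))
    (w : ℝ) (hw : b * F b ≤ w) :
    H w - H (b * F b) ≤ w - b * F b := by
  have hμ := heq.1
  have hbest := heq.2.1 i hi
  have := fun k => (hμ k).1
  set V := v i j with hV
  have hV0 : 0 ≤ V := hv i j
  have hFR (s : ℝ) : F s = (Measure.pi μ).real (FPA.rivalsLE i j s) := by
    rw [hF, measureReal_def]
    congr 2
    ext x
    simp [FPA.rivalsLE, Finset.sup'_le_iff]
  have hsup : Measurable fun x : Fin n → Fin m → ℝ =>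
      (Finset.univ.erase i).sup' hne fun k => x k j := by
    simp_rw [← Finset.sup'_apply hne (fun k (x : Fin n → Fin m → ℝ) => x k j)]
    exact Finset.measurable_sup' hne fun k _ => by fun_prop
  have : IsProbabilityMeasure ((Measure.pi μ).map fun x : Fin n → Fin m → ℝ =>
      (Finset.univ.erase i).sup' hne fun k => x k j) :=
    Measure.isProbabilityMeasure_map hsup.aemeasurable
  have hcdf : F = ProbabilityTheory.cdf ((Measure.pi μ).map fun x : Fin n → Fin m → ℝ =>
      (Finset.univ.erase i).sup' hne fun k => x k j) := by
    ext s
    rw [ProbabilityTheory.cdf_eq_real, measureReal_def,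
      Measure.map_apply hsup measurableSet_Iic, hF]
    rfl
  have hFmono : Monotone F := hcdf ▸ ProbabilityTheory.monotone_cdf _
  have hFcont (x : ℝ) : ContinuousWithinAt F (Set.Ici x) x :=
    hcdf ▸ StieltjesFunction.right_continuous _ x
  have hF0 (s : ℝ) : 0 ≤ F s := by rw [hFR]; exact measureReal_nonneg
  have hF1 (s : ℝ) : F s ≤ 1 := by rw [hFR]; exact measureReal_le_one
  have hpos {δ : ℝ} (hδ : 0 < δ) : 0 < μ i {β | β j ∈ Set.Ioo (b - δ) (b + δ)} := by
    have h := hsupp (Set.Ioo (b - δ) (b + δ)) isOpen_Ioo ⟨by linarith, by linarith⟩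
    rwa [Measure.map_apply (measurable_pi_apply j) measurableSet_Ioo] at h
  have hbF : 0 ≤ b * F b := mul_nonneg hb (hF0 b)
  have hGge : V * F b ≤ G (b * F b) := by
    rw [hG _ hbF]
    refine le_csSup ⟨V, ?_⟩ ⟨b, hb, le_rfl, rfl⟩
    rintro y ⟨s, -, -, rfl⟩
    exact mul_le_of_le_one_right hV0 (hF1 s)
  suffices ∃ A C : ℝ, 0 ≤ A ∧ A ≤ 1 ∧ A * (b * F b) + C = V * F b ∧
      ∀ s, 0 ≤ s → V * F s ≤ A * (s * F s) + C by
    obtain ⟨A, C, hA0, hA1, hAC, hbound⟩ := this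
    refine concaveEnvelope_sub_le hA1 (fun x hx => ?_) hbF (hAC.trans_le hGge) hH hw
    rw [hG x hx]
    refine csSup_le ⟨_, 0, le_rfl, by simpa using hx, rfl⟩ ?_
    rintro y ⟨s, hs, hsx, rfl⟩
    linarith [hbound s hs, mul_le_mul_of_nonneg_left hsx hA0]
  rcases le_or_gt b V with hbV | hVb
  · refine ⟨1, (V - b) * F b, zero_le_one, le_rfl, by ring, fun s hs => ?_⟩
    rcases le_or_gt V s with hVs | hsV
    · linarith [mul_nonneg (sub_nonneg.2 hbV) (hF0 b), mul_le_mul_of_nonneg_right hVs (hF0 s)]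
    have hlim₁ : Filter.Tendsto (fun δ => F s * (V - (s + δ))) (nhdsWithin 0 (Set.Ioi 0))
        (nhds (F s * (V - (s + 0)))) :=
      ((by fun_prop : Continuous fun δ => F s * (V - (s + δ))).tendsto 0).mono_left
        nhdsWithin_le_nhds
    have hlimF : Filter.Tendsto (fun δ => F (b + δ)) (nhdsWithin 0 (Set.Ioi 0)) (nhds (F b)) := by
      refine (hFcont b).tendsto.comp (tendsto_nhdsWithin_iff.2 ⟨?_, ?_⟩)
      · have h : Filter.Tendsto (fun δ : ℝ => b + δ) (nhds 0) (nhds (b + 0)) :=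
          (by fun_prop : Continuous fun δ : ℝ => b + δ).tendsto 0
        rw [add_zero] at h
        exact h.mono_left nhdsWithin_le_nhds
      · filter_upwards [self_mem_nhdsWithin] with δ hδ
        exact le_add_of_nonneg_right (Set.mem_Ioi.1 hδ).le
    have hlim₂ : Filter.Tendsto (fun δ => F (b + δ) * (V - b + δ)) (nhdsWithin 0 (Set.Ioi 0))
        (nhds (F b * (V - b + 0))) :=
      hlimF.mul (((by fun_prop : Continuous fun δ => V - b + δ).tendsto 0).mono_left
        nhdsWithin_le_nhds)
    have hle := le_of_tendsto_of_tendsto hlim₁ hlim₂ (by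
      filter_upwards [Ioo_mem_nhdsGT (sub_pos.2 hsV)] with δ hδ
      rw [hFR, hFR]
      exact hbest.gap_of_le hμ j hbV hδ.1.le (hpos hδ.1) (by linarith [hδ.1])
        (by linarith [hδ.1]) (by linarith [hδ.2]))
    linarith
  · have hb0 : 0 < b := hV0.trans_lt hVb
    refine ⟨V / b, 0, by positivity, (div_le_one hb0).2 hVb.le, by field_simp; ring,
      fun s hs => ?_⟩
    rcases le_or_gt b s with hbs | hsb
    · have h : V / b * (s * F s) = V * F s * (s / b) := by ring
      rw [h, add_zero]
      exact le_mul_of_one_le_right (mul_nonneg hV0 (hF0 s)) ((one_le_div hb0).2 hbs)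
    · obtain ⟨r, hr, hrb⟩ := exists_between (max_lt hsb hVb)
      have hz := hbest.rivalsLE_eq_zero hv hμ j (b := b) (δ := b - r)
        (by linarith [(le_max_right s V).trans_lt hr]) (hpos (by linarith))
      rw [← hFR, sub_sub_cancel] at hz
      have hFs : F s = 0 :=
        le_antisymm (hz ▸ hFmono ((le_max_left s V).trans hr.le)) (hF0 s)
      simp [hFs]
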